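/- For a prime p, α > 0, integer r, and φ a Bruhat–Schwartz function on ℚ_p, the function u(x,t) = (Z_r(·,t) ∗ φ)(x) (with u(x,0)=φ(x)) satisfies ∂u/∂t(x,t) + (H^α u)(x,t) = 0 for all x ∈ ℚ_p and t > 0, where H^α u = 𝓕^{-1}[(max(|ξ|_p,p^r)^α - p^{rα})·𝓕u], and lim_{t→0⁺} u(x,t) = φ(x) for every x. -/

import Mathlib

open MeasureTheory Filter Topology

noncomputable section

variable (p : ℕ) [Fact p.Prime]

instance : MeasurableSpace ℚ_[p] := borel _
instance : BorelSpace ℚ_[p] := ⟨rfl⟩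

/-- The closed unit ball of `ℚ_[p]` (i.e. `ℤ_p`) as a positive compact set. -/
def padicUnitBall : TopologicalSpace.PositiveCompacts ℚ_[p] where
  carrier := Metric.closedBall 0 1
  isCompact' := isCompact_closedBall 0 1
  interior_nonempty' := ⟨0, mem_interior_iff_mem_nhds.2 (Metric.closedBall_mem_nhds 0 one_pos)⟩

/-- Haar measure on `ℚ_[p]` normalized so that `ℤ_p` has measure 1. -/
def μp : Measure ℚ_[p] := Measure.addHaarMeasure (padicUnitBall p)

/-- The heat kernel `Z_r(x,t) = ∫ χ(-xξ) e^{-t(⟨ξ⟩^α - p^{rα})} dξ`, where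
`⟨ξ⟩ = max(|ξ|_p, p^r)`. -/
def heatKernel (χ : AddChar ℚ_[p] ℂ) (r : ℤ) (α t : ℝ) (x : ℚ_[p]) : ℂ :=
  ∫ ξ, χ (-(x*ξ)) *
    Complex.exp (-((t * ((max ‖ξ‖ ((p:ℝ)^r)) ^ α - (p:ℝ) ^ ((r:ℝ)*α)) : ℝ) : ℂ)) ∂(μp p)

/-- The kernel `K_α(y)`, supported on the ball `|y|_p ≤ p^{-r}`. -/
def Kfun (r : ℤ) (α : ℝ) (y : ℚ_[p]) : ℝ :=
  if ‖y‖ ≤ (p:ℝ)^(-r) then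
    (1 - (p:ℝ)^α)/(1 - (p:ℝ)^(-α-1)) * ‖y‖ ^ (-α-1)
      + (p:ℝ)^((r:ℝ)*(α+1)) * (1 - (p:ℝ)^α)/(1 - (p:ℝ)^(α+1))
  else 0

/-- `u(x,t) = ∫_{|ξ|_p ≤ 1} χ(-xξ) e^{-t(⟨ξ⟩^α - p^{rα})} dξ`, the solution with initial
datum the indicator of the unit ball. -/
def uball (χ : AddChar ℚ_[p] ℂ) (r : ℤ) (α t : ℝ) (x : ℚ_[p]) : ℂ :=
  ∫ ξ in {ξ : ℚ_[p] | ‖ξ‖ ≤ 1}, χ (-(x*ξ)) *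
    Complex.exp (-((t * ((max ‖ξ‖ ((p:ℝ)^r)) ^ α - (p:ℝ) ^ ((r:ℝ)*α)) : ℝ) : ℂ)) ∂(μp p)

/-- The survival probability `S(t) = ∫_{|x|_p ≤ 1} u(x,t) dx`. -/
def Sfun (χ : AddChar ℚ_[p] ℂ) (r : ℤ) (α t : ℝ) : ℂ :=
  ∫ x in {x : ℚ_[p] | ‖x‖ ≤ 1}, uball p χ r α t x ∂(μp p)

/-- The solution `u(x,t) = (Z_r(·,t) ∗ φ)(x)` of the Cauchy problem, with `u(x,0) = φ(x)`. -/
def sol (χ : AddChar ℚ_[p] ℂ) (r : ℤ) (α : ℝ) (φ : ℚ_[p] → ℂ) (t : ℝ) (x : ℚ_[p]) : ℂ :=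
  if t = 0 then φ x else ∫ y, heatKernel p χ r α t (x-y) * φ y ∂(μp p)

/-- The pseudodifferential operator `H^α` with symbol `⟨ξ⟩^α - p^{rα}`:
`H^α g = 𝓕⁻¹[(⟨ξ⟩^α - p^{rα}) 𝓕g]`. -/
def Hop (χ : AddChar ℚ_[p] ℂ) (r : ℤ) (α : ℝ) (g : ℚ_[p] → ℂ) (x : ℚ_[p]) : ℂ :=
  ∫ ξ, χ (-(x*ξ)) * (((max ‖ξ‖ ((p:ℝ)^r)) ^ α - (p:ℝ)^((r:ℝ)*α) : ℝ) : ℂ) *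
    (∫ y, χ (ξ*y) * g y ∂(μp p)) ∂(μp p)

/-- The Laplace transform `G_r(s)` of the density `g(t)`. -/
def Gr (χ : AddChar ℚ_[p] ℂ) (r : ℤ) (α : ℝ) (s : ℝ) : ℂ :=
  ∫ y in {y : ℚ_[p] | 1 < ‖y‖ ∧ ‖y‖ ≤ (p:ℝ)^(-r)}, (Kfun p r α y : ℂ) *
    ∫ ξ in {ξ : ℚ_[p] | ‖ξ‖ ≤ 1},
      χ (-(ξ*y)) / ((s:ℂ) + (((max ‖ξ‖ ((p:ℝ)^r)) ^ α - (p:ℝ)^((r:ℝ)*α) : ℝ) : ℂ)) ∂(μp p) ∂(μp p)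

open scoped NNReal ENNReal Pointwise

/-- The symbol `⟨ξ⟩^α - p^{rα}` of `H^α`. -/
def heatSymbol (r : ℤ) (α : ℝ) (ξ : ℚ_[p]) : ℝ :=
  (max ‖ξ‖ ((p : ℝ) ^ r)) ^ α - (p : ℝ) ^ ((r : ℝ) * α)

/-- The multiplier `e^{-t(⟨ξ⟩^α - p^{rα})}` of the heat semigroup. -/
def heatMultiplier (r : ℤ) (α t : ℝ) (ξ : ℚ_[p]) : ℂ :=
  Complex.exp (-((t * heatSymbol p r α ξ : ℝ) : ℂ))

/-- The Fourier transform on `ℚ_[p]` attached to the additive character `χ`. -/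
def padicFourier (χ : AddChar ℚ_[p] ℂ) (f : ℚ_[p] → ℂ) (ξ : ℚ_[p]) : ℂ :=
  ∫ y, χ (ξ * y) * f y ∂(μp p)

variable {p}

instance : (μp p).IsAddHaarMeasure := by unfold μp; infer_instance

lemma padic_cast_pos : (0 : ℝ) < p := by exact_mod_cast (Fact.out : p.Prime).pos

lemma one_lt_padic_cast : (1 : ℝ) < p := by exact_mod_cast (Fact.out : p.Prime).one_lt

lemma padic_measure_closedBall :
    ∃ c : ℝ≥0, c ≠ 0 ∧ ∀ N : ℤ,
      μp p (Metric.closedBall 0 ((p : ℝ) ^ N)) = ((c ^ N : ℝ≥0) : ℝ≥0∞) := by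
  have hp : (p : ℚ_[p]) ≠ 0 := by exact_mod_cast (Fact.out : p.Prime).ne_zero
  set u : ℚ_[p]ˣ := (Units.mk0 (p : ℚ_[p]) hp)⁻¹ with hu
  refine ⟨distribHaarChar ℚ_[p] u, distribHaarChar_pos.ne', fun N => ?_⟩
  have h1 : μp p (Metric.closedBall 0 1) = 1 := Measure.addHaarMeasure_self
  have h2 : (u ^ N) • Metric.closedBall (0 : ℚ_[p]) 1 = Metric.closedBall 0 ((p : ℝ) ^ N) := by
    ext y
    rw [Set.mem_smul_set_iff_inv_smul_mem, mem_closedBall_zero_iff, mem_closedBall_zero_iff,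
      Units.smul_def, smul_eq_mul, norm_mul]
    have : (((u ^ N)⁻¹ : ℚ_[p]ˣ) : ℚ_[p]) = (p : ℚ_[p]) ^ N := by
      simp [hu]
    rw [this, Padic.norm_p_zpow, zpow_neg, inv_mul_le_iff₀ (zpow_pos padic_cast_pos N), mul_one]
  rw [← h2, ← distribHaarChar_mul (μ := μp p), h1, mul_one, map_zpow]

lemma norm_addChar_eq_one {χ : AddChar ℚ_[p] ℂ} (hχ : ∀ y, χ y = 1 ↔ ‖y‖ ≤ 1) (y : ℚ_[p]) :
    ‖χ y‖ = 1 := by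
  obtain ⟨k, hk⟩ : ∃ k : ℕ, ‖y‖ < (p : ℝ) ^ k := pow_unbounded_of_one_lt _ one_lt_padic_cast
  have h : χ y ^ (p ^ k) = 1 := by
    rw [← AddChar.map_nsmul_eq_pow, hχ, nsmul_eq_mul, norm_mul, Nat.cast_pow, norm_pow,
      Padic.norm_p, inv_pow, inv_mul_le_iff₀ (pow_pos padic_cast_pos k), mul_one]
    exact hk.le
  exact Complex.norm_eq_one_of_pow_eq_one h (pow_ne_zero _ (Fact.out : p.Prime).ne_zero)

lemma addChar_mul_eq {χ : AddChar ℚ_[p] ℂ} (hχ : ∀ y, χ y = 1 ↔ ‖y‖ ≤ 1) {x y : ℚ_[p]}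
    (h : ‖x - y‖ ≤ 1) : χ x = χ y := by
  rw [← sub_add_cancel x y, AddChar.map_add_eq_mul, (hχ _).2 h, one_mul]

lemma continuous_of_padic_const {f : ℚ_[p] → ℂ} {n : ℤ}
    (hf : ∀ x y : ℚ_[p], ‖x - y‖ ≤ (p : ℝ) ^ n → f x = f y) : Continuous f := by
  refine IsLocallyConstant.continuous ((IsLocallyConstant.iff_eventually_eq f).2 fun x => ?_)
  filter_upwards [Metric.closedBall_mem_nhds x (zpow_pos (padic_cast_pos (p := p)) n)] with y hy
  exact hf _ _ (by rwa [Metric.mem_closedBall, dist_eq_norm] at hy)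

lemma addChar_continuous {χ : AddChar ℚ_[p] ℂ} (hχ : ∀ y, χ y = 1 ↔ ‖y‖ ≤ 1) :
    Continuous χ :=
  continuous_of_padic_const (n := 0) fun x y h => addChar_mul_eq hχ (by simpa using h)

lemma integrable_of_padic_support {E : Type*} [NormedAddCommGroup E] {f : ℚ_[p] → E} {m : ℤ}
    (hc : Continuous f) (hf : ∀ x : ℚ_[p], (p : ℝ) ^ m < ‖x‖ → f x = 0) :
    Integrable f (μp p) :=
  hc.integrable_of_hasCompactSupport <|
    HasCompactSupport.intro (isCompact_closedBall 0 ((p : ℝ) ^ m)) fun x hx =>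
      hf x (by simpa using hx)

lemma padicFourier_eq_zero {χ : AddChar ℚ_[p] ℂ} (hχ : ∀ y, χ y = 1 ↔ ‖y‖ ≤ 1)
    {f : ℚ_[p] → ℂ} {n : ℤ} (hf : ∀ x y : ℚ_[p], ‖x - y‖ ≤ (p : ℝ) ^ n → f x = f y)
    {ξ : ℚ_[p]} (hξ : (p : ℝ) ^ (-n) < ‖ξ‖) : padicFourier p χ f ξ = 0 := by
  set h : ℚ_[p] := (p : ℚ_[p]) ^ (-n)
  have hh : ‖h‖ = (p : ℝ) ^ n := by rw [Padic.norm_p_zpow, neg_neg]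
  have hne : χ (ξ * h) ≠ 1 := by
    rw [Ne, hχ, not_le, norm_mul, hh]
    rw [zpow_neg, inv_lt_iff_one_lt_mul₀ (zpow_pos padic_cast_pos n)] at hξ
    linarith
  have key : χ (ξ * h) * padicFourier p χ f ξ = padicFourier p χ f ξ := by
    unfold padicFourier
    rw [← integral_const_mul, ← integral_add_right_eq_self (fun y => χ (ξ * y) * f y) h]
    refine integral_congr_ae (.of_forall fun y => ?_)
    simp only
    rw [mul_add, AddChar.map_add_eq_mul, hf (y + h) y (by simp [hh])]
    ring
  have : (χ (ξ * h) - 1) * padicFourier p χ f ξ = 0 := by linear_combination key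
  exact (mul_eq_zero.1 this).resolve_left (sub_ne_zero.2 hne)

lemma padicFourier_const {χ : AddChar ℚ_[p] ℂ} (hχ : ∀ y, χ y = 1 ↔ ‖y‖ ≤ 1)
    {f : ℚ_[p] → ℂ} {m : ℤ} (hf : ∀ x : ℚ_[p], (p : ℝ) ^ m < ‖x‖ → f x = 0)
    (ξ η : ℚ_[p]) (h : ‖ξ - η‖ ≤ (p : ℝ) ^ (-m)) :
    padicFourier p χ f ξ = padicFourier p χ f η := by
  refine integral_congr_ae (.of_forall fun y => ?_)
  simp only
  rcases lt_or_ge ((p : ℝ) ^ m) ‖y‖ with hy | hy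
  · simp [hf y hy]
  · rw [addChar_mul_eq hχ (x := ξ * y) (y := η * y)]
    rw [← sub_mul, norm_mul]
    calc ‖ξ - η‖ * ‖y‖ ≤ (p : ℝ) ^ (-m) * (p : ℝ) ^ m := by
          gcongr
      _ = 1 := by rw [zpow_neg, inv_mul_cancel₀ (zpow_pos padic_cast_pos m).ne']

lemma integral_kernel_mul_eq {χ : AddChar ℚ_[p] ℂ} (hχ : ∀ y, χ y = 1 ↔ ‖y‖ ≤ 1)
    {e g : ℚ_[p] → ℂ} (he : Integrable e (μp p)) (hg : Integrable g (μp p)) (x : ℚ_[p]) :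
    ∫ y, (∫ ξ, χ (-((x - y) * ξ)) * e ξ ∂(μp p)) * g y ∂(μp p) =
      ∫ ξ, χ (-(x * ξ)) * (e ξ * padicFourier p χ g ξ) ∂(μp p) := by
  have hint : Integrable
      (fun z : ℚ_[p] × ℚ_[p] => χ (-((x - z.1) * z.2)) * (g z.1 * e z.2))
      ((μp p).prod (μp p)) := by
    refine (hg.mul_prod he).bdd_mul (c := 1) ?_ (.of_forall fun z => (norm_addChar_eq_one hχ _).le)
    exact ((addChar_continuous hχ).comp (by fun_prop)).aestronglyMeasurable
  calc _ = ∫ y, ∫ ξ, χ (-((x - y) * ξ)) * (g y * e ξ) ∂(μp p) ∂(μp p) := by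
        refine integral_congr_ae (.of_forall fun y => ?_)
        simp only
        rw [← integral_mul_const]
        congr 1; ext ξ; ring
    _ = ∫ ξ, ∫ y, χ (-((x - y) * ξ)) * (g y * e ξ) ∂(μp p) ∂(μp p) :=
        integral_integral_swap hint
    _ = _ := by
        refine integral_congr_ae (.of_forall fun ξ => ?_)
        simp only [padicFourier]
        rw [← integral_const_mul, ← integral_const_mul]
        congr 1; ext y
        rw [show -((x - y) * ξ) = -(x * ξ) + ξ * y by ring, AddChar.map_add_eq_mul]
        ring

/-- Fourier inversion for Bruhat–Schwartz functions on `ℚ_[p]`. -/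
theorem padicFourier_inversion {χ : AddChar ℚ_[p] ℂ} (hχ : ∀ y, χ y = 1 ↔ ‖y‖ ≤ 1)
    {g : ℚ_[p] → ℂ} {n m : ℤ} (hn : ∀ x y : ℚ_[p], ‖x - y‖ ≤ (p : ℝ) ^ n → g x = g y)
    (hm : ∀ x : ℚ_[p], (p : ℝ) ^ m < ‖x‖ → g x = 0) (x : ℚ_[p]) :
    ∫ ξ, χ (-(x * ξ)) * padicFourier p χ g ξ ∂(μp p) = g x := by
  obtain ⟨c, hc, hvol⟩ := padic_measure_closedBall (p := p)
  set B : Set ℚ_[p] := Metric.closedBall 0 ((p : ℝ) ^ (-n)) with hB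
  set k : ℚ_[p] → ℂ := B.indicator 1 with hk
  have hBm : MeasurableSet B := measurableSet_closedBall
  have hmem : ∀ ξ : ℚ_[p], ξ ∈ B ↔ ‖ξ‖ ≤ (p : ℝ) ^ (-n) := fun ξ => by simp [hB]
  have hk_const : ∀ ξ η : ℚ_[p], ‖ξ - η‖ ≤ (p : ℝ) ^ (-n) → k ξ = k η := by
    have aux : ∀ ξ η : ℚ_[p], ‖ξ - η‖ ≤ (p : ℝ) ^ (-n) → ξ ∈ B → η ∈ B := by
      intro ξ η h hξ
      rw [hmem] at hξ ⊢
      have := Padic.nonarchimedean (η - ξ) ξ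
      rw [sub_add_cancel, norm_sub_rev] at this
      exact this.trans (max_le h hξ)
    intro ξ η h
    have : ξ ∈ B ↔ η ∈ B := ⟨aux ξ η h, aux η ξ (by rwa [norm_sub_rev])⟩
    by_cases hη : η ∈ B <;> simp [hk, this, hη]
  have hk_int : Integrable k (μp p) :=
    integrable_of_padic_support (continuous_of_padic_const hk_const) (m := -n) fun ξ hξ =>
      Set.indicator_of_notMem (by rw [hmem]; exact hξ.not_ge) _
  have hg_int : Integrable g (μp p) :=
    integrable_of_padic_support (continuous_of_padic_const hn) hm
  have hker : ∀ y, (∫ ξ, χ (-((x - y) * ξ)) * k ξ ∂(μp p)) * g y =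
      (Metric.closedBall x ((p : ℝ) ^ n)).indicator (fun _ => ((c ^ (-n) : ℝ≥0) : ℂ) * g x) y := by
    intro y
    have e1 : ∫ ξ, χ (-((x - y) * ξ)) * k ξ ∂(μp p) = padicFourier p χ k (y - x) := by
      unfold padicFourier
      congr 1; ext ξ
      rw [show -((x - y) * ξ) = (y - x) * ξ by ring]
    rw [e1]
    by_cases hy : ‖y - x‖ ≤ (p : ℝ) ^ n
    · rw [Set.indicator_of_mem (by rwa [Metric.mem_closedBall, dist_eq_norm]), hn y x hy]
      congr 1
      have : ∀ ξ, χ ((y - x) * ξ) * k ξ = k ξ := by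
        intro ξ
        by_cases hξ : ξ ∈ B
        · rw [(hχ _).2, one_mul]
          rw [norm_mul]
          rw [hmem] at hξ
          calc ‖y - x‖ * ‖ξ‖ ≤ (p : ℝ) ^ n * (p : ℝ) ^ (-n) := by gcongr
            _ = 1 := by rw [zpow_neg, mul_inv_cancel₀ (zpow_pos padic_cast_pos n).ne']
        · simp [hk, hξ]
      unfold padicFourier
      simp_rw [this]
      rw [hk, integral_indicator hBm]
      simp [Measure.real, hB, hvol, -zpow_neg]
    · rw [Set.indicator_of_notMem (by rwa [Metric.mem_closedBall, dist_eq_norm]),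
        padicFourier_eq_zero hχ hk_const (by rw [neg_neg]; exact not_le.1 hy), zero_mul]
  have hcut : ∀ ξ, χ (-(x * ξ)) * padicFourier p χ g ξ =
      χ (-(x * ξ)) * (k ξ * padicFourier p χ g ξ) := by
    intro ξ
    by_cases hξ : ξ ∈ B
    · simp [hk, hξ]
    · rw [padicFourier_eq_zero hχ hn (by rw [hmem] at hξ; exact not_le.1 hξ)]; simp
  simp_rw [hcut]
  rw [← integral_kernel_mul_eq hχ hk_int hg_int]
  simp_rw [hker]
  have hvolx : μp p (Metric.closedBall x ((p : ℝ) ^ n)) = ((c ^ n : ℝ≥0) : ℝ≥0∞) := by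
    rw [← hvol, Measure.addHaar_closedBall_center]
  rw [integral_indicator_const _ measurableSet_closedBall, Measure.real, hvolx]
  simp only [ENNReal.coe_toReal, Complex.real_smul]
  rw [← mul_assoc, ← Complex.ofReal_mul, ← NNReal.coe_mul, zpow_neg,
    mul_inv_cancel₀ (zpow_ne_zero _ hc)]
  simp

lemma heatSymbol_nonneg (r : ℤ) {α : ℝ} (hα : 0 < α) (ξ : ℚ_[p]) : 0 ≤ heatSymbol p r α ξ := by
  unfold heatSymbol
  have h := zpow_pos (padic_cast_pos (p := p)) r
  rw [sub_nonneg, Real.rpow_mul padic_cast_pos.le, Real.rpow_intCast]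
  exact Real.rpow_le_rpow h.le (le_max_right _ _) hα.le

lemma heatSymbol_continuous (r : ℤ) {α : ℝ} (hα : 0 < α) : Continuous (heatSymbol p r α) := by
  unfold heatSymbol
  exact ((continuous_norm.max continuous_const).rpow_const fun _ => Or.inr hα.le).sub
    continuous_const

lemma heatSymbol_const (r : ℤ) (α : ℝ) {ξ η : ℚ_[p]} (h : ‖ξ - η‖ ≤ (p : ℝ) ^ r) :
    heatSymbol p r α ξ = heatSymbol p r α η := by
  have aux : ∀ ξ η : ℚ_[p], ‖ξ - η‖ ≤ (p : ℝ) ^ r → ‖ξ‖ ≤ max ‖η‖ ((p : ℝ) ^ r) := by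
    intro ξ η h
    have := Padic.nonarchimedean (ξ - η) η
    rw [sub_add_cancel] at this
    exact this.trans (max_le ((h.trans (le_max_right _ _))) (le_max_left _ _))
  unfold heatSymbol
  rw [le_antisymm (max_le (aux ξ η h) (le_max_right _ _))
    (max_le (aux η ξ (by rwa [norm_sub_rev])) (le_max_right _ _))]

lemma heatMultiplier_continuous (r : ℤ) {α : ℝ} (hα : 0 < α) (t : ℝ) :
    Continuous (heatMultiplier p r α t) := by
  have := heatSymbol_continuous (p := p) r hα
  unfold heatMultiplier
  fun_prop

lemma norm_heatMultiplier (r : ℤ) (α t : ℝ) (ξ : ℚ_[p]) :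
    ‖heatMultiplier p r α t ξ‖ = Real.exp (-(t * heatSymbol p r α ξ)) := by
  rw [heatMultiplier, Complex.norm_exp]
  simp

lemma norm_heatMultiplier_le_one (r : ℤ) {α : ℝ} (hα : 0 < α) {t : ℝ} (ht : 0 ≤ t) (ξ : ℚ_[p]) :
    ‖heatMultiplier p r α t ξ‖ ≤ 1 := by
  rw [norm_heatMultiplier, Real.exp_le_one_iff, neg_nonpos]
  exact mul_nonneg ht (heatSymbol_nonneg r hα ξ)

lemma summable_exp_neg_mul_pow_mul_pow {t q : ℝ} (ht : 0 < t) (hq : 1 < q) {c : ℝ} (hc : 0 < c) :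
    Summable fun N : ℕ => Real.exp (-(t * q ^ N)) * c ^ N := by
  obtain ⟨k, hk⟩ := pow_unbounded_of_one_lt c hq
  have hq0 : 0 < q := one_pos.trans hq
  have hs : Summable fun N : ℕ => (k.factorial / t ^ k) * (c / q ^ k) ^ N :=
    (summable_geometric_of_lt_one (by positivity) ((div_lt_one (by positivity)).2 hk)).mul_left _
  refine Summable.of_nonneg_of_le (fun N => by positivity) (fun N => ?_) hs
  have h := Real.pow_div_factorial_le_exp (t * q ^ N) (by positivity) k
  have h2 : Real.exp (-(t * q ^ N)) ≤ k.factorial / (t * q ^ N) ^ k := by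
    rw [Real.exp_neg, ← inv_div]
    exact inv_anti₀ (by positivity) h
  calc Real.exp (-(t * q ^ N)) * c ^ N ≤ k.factorial / (t * q ^ N) ^ k * c ^ N := by gcongr
    _ = _ := by
      rw [mul_pow, div_pow, ← pow_mul, ← pow_mul, mul_comm N k]
      field_simp

lemma heatMultiplier_integrable (r : ℤ) {α : ℝ} (hα : 0 < α) {t : ℝ} (ht : 0 < t) :
    Integrable (heatMultiplier p r α t) (μp p) := by
  obtain ⟨c, hc, hvol⟩ := padic_measure_closedBall (p := p)
  have hp1 := one_lt_padic_cast (p := p)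
  have hp0 := padic_cast_pos (p := p)
  refine ⟨(heatMultiplier_continuous r hα t).aestronglyMeasurable, ?_⟩
  set q : ℝ := (p : ℝ) ^ α
  have hq : 1 < q := Real.one_lt_rpow hp1 hα
  set K : ℝ := Real.exp (t * ((p : ℝ) ^ ((r : ℝ) * α) + 1)) with hK
  set b : ℕ → ℝ := fun N => K * Real.exp (-(t * q ^ N))
  have hb : ∀ N, 0 ≤ b N := fun N => by positivity
  have hsum : Summable fun N : ℕ => b N * (c : ℝ) ^ N := by
    simpa [b, mul_assoc] using
      (summable_exp_neg_mul_pow_mul_pow ht hq (c := c) (by positivity)).mul_left K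
  have hbound : ∀ ξ : ℚ_[p], ‖heatMultiplier p r α t ξ‖ₑ ≤
      ∑' N : ℕ, (Metric.closedBall (0 : ℚ_[p]) ((p : ℝ) ^ (N : ℤ))).indicator
        (fun _ => ENNReal.ofReal (b N)) ξ := by
    intro ξ
    obtain ⟨N, hN, hle⟩ : ∃ N : ℕ, ‖ξ‖ ≤ (p : ℝ) ^ (N : ℤ) ∧
        ‖heatMultiplier p r α t ξ‖ ≤ b N := by
      rcases le_or_gt ‖ξ‖ 1 with h | h
      · refine ⟨0, by simpa using h, (norm_heatMultiplier_le_one r hα ht.le ξ).trans ?_⟩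
        simp only [b, hK, ← Real.exp_add]
        rw [Real.one_le_exp_iff]
        have : 0 < (p : ℝ) ^ ((r : ℝ) * α) := Real.rpow_pos_of_pos hp0 _
        nlinarith [mul_pos ht this]
      · have hξ : ξ ≠ 0 := fun h0 => by simp [h0] at h; linarith
        obtain ⟨v, hv⟩ : ∃ v : ℤ, ‖ξ‖ = (p : ℝ) ^ v := ⟨_, Padic.norm_eq_zpow_neg_valuation hξ⟩
        have hv0 : 0 ≤ v := by
          rw [hv] at h
          exact ((one_lt_zpow_iff_right₀ hp1).1 h).le
        lift v to ℕ using hv0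
        refine ⟨v, hv.le, ?_⟩
        rw [norm_heatMultiplier]
        simp only [b, hK, ← Real.exp_add]
        rw [Real.exp_le_exp]
        have h3 : q ^ v ≤ (max ‖ξ‖ ((p : ℝ) ^ r)) ^ α := by
          have : q ^ v = ‖ξ‖ ^ α := by
            rw [hv, zpow_natCast, ← Real.rpow_natCast, ← Real.rpow_natCast, ← Real.rpow_mul hp0.le,
              ← Real.rpow_mul hp0.le, mul_comm]
          rw [this]
          exact Real.rpow_le_rpow (norm_nonneg _) (le_max_left _ _) hα.le
        unfold heatSymbol
        nlinarith [mul_le_mul_of_nonneg_left h3 ht.le]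
    calc ‖heatMultiplier p r α t ξ‖ₑ ≤ ENNReal.ofReal (b N) := by
          rw [← ofReal_norm]
          exact ENNReal.ofReal_le_ofReal hle
      _ = (Metric.closedBall (0 : ℚ_[p]) ((p : ℝ) ^ (N : ℤ))).indicator
            (fun _ => ENNReal.ofReal (b N)) ξ := by
          rw [Set.indicator_of_mem (by simpa using hN)]
      _ ≤ _ := ENNReal.le_tsum N
  refine (lintegral_mono hbound).trans_lt ?_
  rw [lintegral_tsum fun N =>
    (measurable_const.indicator measurableSet_closedBall).aemeasurable]
  have hterm : ∀ N : ℕ, ∫⁻ ξ, (Metric.closedBall (0 : ℚ_[p]) ((p : ℝ) ^ (N : ℤ))).indicator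
      (fun _ => ENNReal.ofReal (b N)) ξ ∂(μp p) = ENNReal.ofReal (b N * (c : ℝ) ^ N) := by
    intro N
    rw [lintegral_indicator_const measurableSet_closedBall, hvol, ENNReal.ofReal_mul (hb N),
      zpow_natCast, ← NNReal.coe_pow, ENNReal.ofReal_coe_nnreal]
  simp_rw [hterm]
  rw [← ENNReal.ofReal_tsum_of_nonneg (fun N => by have := hb N; positivity) hsum]
  exact ENNReal.ofReal_lt_top

lemma sol_eq_integral {χ : AddChar ℚ_[p] ℂ} (hχ : ∀ y, χ y = 1 ↔ ‖y‖ ≤ 1) (r : ℤ) {α : ℝ}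
    (hα : 0 < α) {φ : ℚ_[p] → ℂ} (hφ : Integrable φ (μp p)) {t : ℝ} (ht : 0 < t) (x : ℚ_[p]) :
    sol p χ r α φ t x =
      ∫ ξ, χ (-(x * ξ)) * (heatMultiplier p r α t ξ * padicFourier p χ φ ξ) ∂(μp p) := by
  rw [sol, if_neg ht.ne', ← integral_kernel_mul_eq hχ (heatMultiplier_integrable r hα ht) hφ]
  rfl

/-- The solution has Fourier transform `e^{-t(⟨ξ⟩^α - p^{rα})} (𝓕φ)(ξ)`. -/
lemma padicFourier_sol {χ : AddChar ℚ_[p] ℂ} (hχ : ∀ y, χ y = 1 ↔ ‖y‖ ≤ 1) (r : ℤ) {α : ℝ}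
    (hα : 0 < α) {φ : ℚ_[p] → ℂ} {n m : ℤ}
    (hn : ∀ x y : ℚ_[p], ‖x - y‖ ≤ (p : ℝ) ^ n → φ x = φ y)
    (hm : ∀ x : ℚ_[p], (p : ℝ) ^ m < ‖x‖ → φ x = 0) {t : ℝ} (ht : 0 < t) (ξ : ℚ_[p]) :
    padicFourier p χ (sol p χ r α φ t) ξ =
      heatMultiplier p r α t ξ * padicFourier p χ φ ξ := by
  have hφ := integrable_of_padic_support (continuous_of_padic_const hn) hm
  have hχ' : ∀ y, χ⁻¹ y = 1 ↔ ‖y‖ ≤ 1 := fun y => by rw [AddChar.inv_apply, hχ, norm_neg]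
  have hconst : ∀ ξ η : ℚ_[p], ‖ξ - η‖ ≤ (p : ℝ) ^ (min r (-m)) →
      heatMultiplier p r α t ξ * padicFourier p χ φ ξ =
        heatMultiplier p r α t η * padicFourier p χ φ η := by
    intro ξ η h
    have hp1 := (one_lt_padic_cast (p := p)).le
    rw [padicFourier_const hχ hm ξ η (h.trans (zpow_le_zpow_right₀ hp1 (min_le_right _ _))),
      heatMultiplier, heatMultiplier,
      heatSymbol_const r α (h.trans (zpow_le_zpow_right₀ hp1 (min_le_left _ _)))]
  have hsupp : ∀ ξ : ℚ_[p], (p : ℝ) ^ (-n) < ‖ξ‖ →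
      heatMultiplier p r α t ξ * padicFourier p χ φ ξ = 0 := fun ξ h => by
    rw [padicFourier_eq_zero hχ hn h, mul_zero]
  rw [← padicFourier_inversion hχ' hconst hsupp ξ]
  refine integral_congr_ae (.of_forall fun y => ?_)
  simp only [sol_eq_integral hχ r hα hφ ht, padicFourier, AddChar.inv_apply, neg_neg]

variable (p)

theorem stmt18 (χ : AddChar ℚ_[p] ℂ) (hχ : ∀ y : ℚ_[p], χ y = 1 ↔ ‖y‖ ≤ 1) (r : ℤ) (α : ℝ) (hα : 0 < α)
    (φ : ℚ_[p] → ℂ)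
    (hφconst : ∃ n : ℤ, ∀ x y : ℚ_[p], ‖x - y‖ ≤ (p:ℝ)^n → φ x = φ y)
    (hφsupp : ∃ m : ℤ, ∀ x : ℚ_[p], (p:ℝ)^m < ‖x‖ → φ x = 0) :
    (∀ x : ℚ_[p], ∀ t : ℝ, 0 < t →
      HasDerivAt (fun s : ℝ => sol p χ r α φ s x)
        (-(Hop p χ r α (sol p χ r α φ t) x)) t) ∧
    (∀ x : ℚ_[p], Tendsto (fun t : ℝ => sol p χ r α φ t x) (𝓝[>] (0:ℝ)) (𝓝 (φ x))) := by
  obtain ⟨n, hn⟩ := hφconst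
  obtain ⟨m, hm⟩ := hφsupp
  have hφ := integrable_of_padic_support (continuous_of_padic_const hn) hm
  have hF_supp : ∀ ξ : ℚ_[p], (p : ℝ) ^ (-n) < ‖ξ‖ → padicFourier p χ φ ξ = 0 :=
    fun ξ h => padicFourier_eq_zero hχ hn h
  have hF_cont : Continuous (padicFourier p χ φ) :=
    continuous_of_padic_const (padicFourier_const hχ hm)
  have hχ_cont := addChar_continuous hχ
  have ha_cont := heatSymbol_continuous (p := p) r hα
  have hE_cont := fun t => heatMultiplier_continuous (p := p) r hα t
  refine ⟨fun x t ht => ?_, fun x => ?_⟩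
  · have key := hasDerivAt_integral_of_dominated_loc_of_deriv_le (μ := μp p) (𝕜 := ℝ)
      (F := fun s ξ => χ (-(x * ξ)) * (heatMultiplier p r α s ξ * padicFourier p χ φ ξ))
      (F' := fun s ξ => χ (-(x * ξ)) * ((-(heatSymbol p r α ξ : ℂ) * heatMultiplier p r α s ξ) *
        padicFourier p χ φ ξ))
      (bound := fun ξ => heatSymbol p r α ξ * ‖padicFourier p χ φ ξ‖)
      (x₀ := t) (Ioi_mem_nhds ht)
      (.of_forall fun s => Continuous.aestronglyMeasurable (by have := hE_cont s; fun_prop))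
      (integrable_of_padic_support (by have := hE_cont t; fun_prop) (m := -n) fun ξ h => by
        simp [hF_supp ξ h])
      (Continuous.aestronglyMeasurable (by have := hE_cont t; fun_prop))
      (.of_forall fun ξ s hs => by
        rw [norm_mul, norm_addChar_eq_one hχ, one_mul, norm_mul, norm_mul, norm_neg,
          Complex.norm_of_nonneg (heatSymbol_nonneg r hα ξ)]
        have h1 := norm_heatMultiplier_le_one (p := p) r hα (le_of_lt hs) ξ
        have h2 := heatSymbol_nonneg r hα ξ
        gcongr
        exact mul_le_of_le_one_right h2 h1)
      (integrable_of_padic_support (by fun_prop) (m := -n) fun ξ h => by simp [hF_supp ξ h])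
      (.of_forall fun ξ s hs => by
        have h1 : HasDerivAt (fun s : ℝ => ((s * heatSymbol p r α ξ : ℝ) : ℂ))
            (heatSymbol p r α ξ : ℂ) s := by
          simpa using ((hasDerivAt_id s).mul_const (heatSymbol p r α ξ)).ofReal_comp
        have h2 : HasDerivAt (fun s : ℝ => heatMultiplier p r α s ξ)
            (-(heatSymbol p r α ξ : ℂ) * heatMultiplier p r α s ξ) s := by
          simpa [heatMultiplier, mul_comm] using h1.neg.cexp
        exact (h2.mul_const _).const_mul _)
    have hHop : -(Hop p χ r α (sol p χ r α φ t) x) =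
        ∫ ξ, χ (-(x * ξ)) * ((-(heatSymbol p r α ξ : ℂ) * heatMultiplier p r α t ξ) *
          padicFourier p χ φ ξ) ∂(μp p) := by
      rw [Hop, ← integral_neg]
      refine integral_congr_ae (.of_forall fun ξ => ?_)
      have := padicFourier_sol hχ r hα hn hm ht ξ
      simp only [padicFourier, heatSymbol] at this ⊢
      rw [this]
      ring
    rw [hHop]
    refine key.2.congr_of_eventuallyEq ?_
    filter_upwards [Ioi_mem_nhds ht] with s hs
    exact sol_eq_integral hχ r hα hφ hs x
  · rw [← padicFourier_inversion hχ hn hm x]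
    have key : Tendsto
        (fun t => ∫ ξ, χ (-(x * ξ)) * (heatMultiplier p r α t ξ * padicFourier p χ φ ξ) ∂(μp p))
        (𝓝[>] (0 : ℝ)) (𝓝 (∫ ξ, χ (-(x * ξ)) * padicFourier p χ φ ξ ∂(μp p))) := by
      refine tendsto_integral_filter_of_dominated_convergence (fun ξ => ‖padicFourier p χ φ ξ‖)
        (.of_forall fun s => Continuous.aestronglyMeasurable (by have := hE_cont s; fun_prop))
        ?_ (integrable_of_padic_support (by fun_prop) (m := -n) fun ξ h => by
          simp [hF_supp ξ h]) (.of_forall fun ξ => ?_)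
      · filter_upwards [self_mem_nhdsWithin] with s hs
        refine .of_forall fun ξ => ?_
        rw [norm_mul, norm_addChar_eq_one hχ, one_mul, norm_mul]
        exact mul_le_of_le_one_left (norm_nonneg _)
          (norm_heatMultiplier_le_one r hα (le_of_lt hs) ξ)
      · have h1 : Continuous fun s : ℝ =>
            χ (-(x * ξ)) * (heatMultiplier p r α s ξ * padicFourier p χ φ ξ) := by
          unfold heatMultiplier
          fun_prop
        simpa [heatMultiplier] using (h1.tendsto 0).mono_left nhdsWithin_le_nhds
    refine key.congr' ?_
    filter_upwards [self_mem_nhdsWithin] with s hs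
    exact (sol_eq_integral hχ r hα hφ hs x).symm

end
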